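/- Suppose 𝒜 generates a C₀-semigroup on L²(Ω, μ; H), and let Ω' ⊆ Ω be measurable with μ(Ω') > 0. Let L²(Ω') := {x ∈ L²(Ω, μ; H) : x(s) = 0 for a.e. s ∉ Ω'}, a closed subspace of L²(Ω, μ; H). Then the operator 𝒜' with domain D(𝒜) ∩ L²(Ω') given by 𝒜'x = 𝒜x maps its domain into L²(Ω') and generates a C₀-semigroup on L²(Ω'). -/

import Mathlib

open MeasureTheory Filter Topology Set

noncomputable section

/-- A `C₀`-semigroup: a family `(T t)_{t ≥ 0}` of bounded operators with `T 0 = I`,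
`T (t+u) = T t ∘ T u` for `t, u ≥ 0`, and `t ↦ T t x` continuous on `[0, ∞)` for each `x`.
(Values at negative times are irrelevant.) -/
def IsC0Semigroup {K : Type*} [NormedAddCommGroup K] [NormedSpace ℂ K]
    (T : ℝ → K →L[ℂ] K) : Prop :=
  T 0 = 1 ∧
  (∀ t u : ℝ, 0 ≤ t → 0 ≤ u → T (t + u) = (T t).comp (T u)) ∧
  ∀ x : K, ContinuousOn (fun t => T t x) (Set.Ici (0 : ℝ))

/-- `R` is the resolvent of the (possibly unbounded) operator `B` at `lam`, i.e.
`lam ∈ ρ(B)` with `R = (lam - B)⁻¹` as a bounded operator. -/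
def ResolventAt {K : Type*} [NormedAddCommGroup K] [NormedSpace ℂ K]
    (B : K →ₗ.[ℂ] K) (lam : ℂ) (R : K →L[ℂ] K) : Prop :=
  (∀ y : K, ∃ hy : R y ∈ B.domain, lam • R y - B ⟨R y, hy⟩ = y) ∧
  ∀ x : B.domain, R (lam • (x : K) - B x) = x

/-- `B` is the generator of the semigroup `T`: its domain is the set of `x` for which
`t⁻¹ (T t x - x)` converges as `t → 0⁺`, and `B x` is that limit. -/
def IsGenerator {K : Type*} [NormedAddCommGroup K] [NormedSpace ℂ K]
    (T : ℝ → K →L[ℂ] K) (B : K →ₗ.[ℂ] K) : Prop :=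
  (∀ x : K, x ∈ B.domain ↔
    ∃ y : K, Tendsto (fun t : ℝ => t⁻¹ • (T t x - x)) (𝓝[>] (0:ℝ)) (𝓝 y)) ∧
  ∀ x : B.domain, Tendsto (fun t : ℝ => t⁻¹ • (T t (x : K) - (x : K))) (𝓝[>] (0:ℝ)) (𝓝 (B x))

variable {Ω : Type*} [MeasurableSpace Ω] {μ : Measure Ω} [SigmaFinite μ]
variable {H : Type*} [NormedAddCommGroup H] [InnerProductSpace ℂ H] [CompleteSpace H]
  [TopologicalSpace.SeparableSpace H]

/-- A `C₀`-semigroup on a Banach space is bounded on compact time intervals. -/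
lemma IsC0Semigroup.exists_norm_le {X : Type*} [NormedAddCommGroup X] [NormedSpace ℂ X]
    [CompleteSpace X] {T : ℝ → X →L[ℂ] X} (hT : IsC0Semigroup T) (t : ℝ) :
    ∃ M : ℝ, ∀ s ∈ Set.Icc 0 t, ‖T s‖ ≤ M := by
  obtain ⟨M, hM⟩ := banach_steinhaus (g := fun s : Set.Icc (0 : ℝ) t => T s) (by
    intro x
    obtain ⟨C, hC⟩ := isCompact_Icc.exists_bound_of_continuousOn
      ((hT.2.2 x).mono (Set.Icc_subset_Ici_self : Set.Icc 0 t ⊆ _))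
    exact ⟨C, fun s => hC s s.2⟩)
  exact ⟨M, fun s hs => hM ⟨s, hs⟩⟩

/-- Applying a strongly continuous, uniformly bounded family of operators to a convergent family
of vectors. -/
lemma tendsto_clm_apply_of_norm_le {X ι : Type*} [NormedAddCommGroup X] [NormedSpace ℂ X]
    {l : Filter ι} {A : ι → X →L[ℂ] X} {u : ι → X} {u₀ y : X} {M : ℝ}
    (hM : ∀ᶠ i in l, ‖A i‖ ≤ M) (hu : Tendsto u l (𝓝 u₀))
    (hA : Tendsto (fun i => A i u₀) l (𝓝 y)) :
    Tendsto (fun i => A i (u i)) l (𝓝 y) := by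
  have h0 : Tendsto (fun i => A i (u i - u₀)) l (𝓝 0) := by
    refine squeeze_zero_norm' (a := fun i => M * ‖u i - u₀‖) ?_ ?_
    · filter_upwards [hM] with i hi
      exact (A i).le_of_opNorm_le hi _
    · have := (hu.sub_const u₀).norm.const_mul M
      simpa using this
  simpa using h0.add hA

/-- The generator commutes with the semigroup. -/
lemma IsGenerator.apply_mem_graph {X : Type*} [NormedAddCommGroup X] [NormedSpace ℂ X]
    {T : ℝ → X →L[ℂ] X} {B : X →ₗ.[ℂ] X} (hT : IsC0Semigroup T) (hB : IsGenerator T B)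
    {x y : X} (hxy : (x, y) ∈ B.graph) {t : ℝ} (ht : 0 ≤ t) : (T t x, T t y) ∈ B.graph := by
  obtain ⟨hx, rfl⟩ : ∃ hx : x ∈ B.domain, B ⟨x, hx⟩ = y := by
    obtain ⟨z, rfl, rfl⟩ := (LinearPMap.mem_graph_iff B).1 hxy
    exact ⟨z.2, rfl⟩
  have hlim : Tendsto (fun h : ℝ => h⁻¹ • (T h (T t x) - T t x)) (𝓝[>] (0 : ℝ))
      (𝓝 (T t (B ⟨x, hx⟩))) := by
    refine Tendsto.congr' ?_ (((T t).continuous.tendsto _).comp (hB.2 ⟨x, hx⟩))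
    filter_upwards [self_mem_nhdsWithin] with h hh
    have hcomm : T h (T t x) = T t (T h x) := by
      rw [← ContinuousLinearMap.comp_apply, ← ContinuousLinearMap.comp_apply,
        ← hT.2.1 h t (le_of_lt hh) ht, ← hT.2.1 t h ht (le_of_lt hh), add_comm]
    simp [hcomm, ← Complex.coe_smul]
  have hmem : T t x ∈ B.domain := (hB.1 _).2 ⟨_, hlim⟩
  exact (LinearPMap.mem_graph_iff B).2
    ⟨⟨_, hmem⟩, rfl, tendsto_nhds_unique (hB.2 ⟨_, hmem⟩) hlim⟩

lemma IsGenerator.tendsto_of_mem_graph {X : Type*} [NormedAddCommGroup X] [NormedSpace ℂ X]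
    {T : ℝ → X →L[ℂ] X} {B : X →ₗ.[ℂ] X} (hB : IsGenerator T B)
    {x y : X} (hxy : (x, y) ∈ B.graph) :
    Tendsto (fun h : ℝ => h⁻¹ • (T h x - x)) (𝓝[>] (0 : ℝ)) (𝓝 y) := by
  obtain ⟨z, rfl, rfl⟩ := (LinearPMap.mem_graph_iff B).1 hxy
  exact hB.2 z

/-- A bounded operator commuting with the generator of a `C₀`-semigroup commutes with the semigroup
on the domain of the generator. -/
lemma IsGenerator.apply_comm_of_mem_domain {X : Type*} [NormedAddCommGroup X] [NormedSpace ℂ X]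
    [CompleteSpace X] {T : ℝ → X →L[ℂ] X} {B : X →ₗ.[ℂ] X} (hT : IsC0Semigroup T)
    (hB : IsGenerator T B) {P : X →L[ℂ] X}
    (hP : ∀ x y : X, (x, y) ∈ B.graph → (P x, P y) ∈ B.graph)
    {x : X} (hx : x ∈ B.domain) {t : ℝ} (ht : 0 ≤ t) : P (T t x) = T t (P x) := by
  obtain ⟨M, hM⟩ := hT.exists_norm_le t
  have hxy : (x, B ⟨x, hx⟩) ∈ B.graph := B.mem_graph ⟨x, hx⟩
  set y := B ⟨x, hx⟩
  have hcont : ContinuousOn (fun r => T (t - r) (P (T r x))) (Set.Icc 0 t) := by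
    intro r hr
    refine tendsto_clm_apply_of_norm_le (M := M) (u₀ := P (T r x)) ?_ ?_ ?_
    · filter_upwards [self_mem_nhdsWithin] with s hs
      exact hM _ ⟨sub_nonneg.2 hs.2, sub_le_self _ hs.1⟩
    · exact (P.continuous.tendsto _).comp
        (((hT.2.2 x) r hr.1).mono Set.Icc_subset_Ici_self)
    · refine ContinuousOn.comp (t := Set.Ici 0) (hT.2.2 (P (T r x)))
        (f := fun s => t - s) (by fun_prop) ?_ r hr
      exact fun s hs => sub_nonneg.2 hs.2
  have hderiv : ∀ r ∈ Set.Ico 0 t,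
      HasDerivWithinAt (fun r => T (t - r) (P (T r x))) 0 (Set.Ici r) r := by
    intro r hr
    rw [← hasDerivWithinAt_Ioi_iff_Ici, hasDerivWithinAt_iff_tendsto_slope' (by simp)]
    have hTr := IsGenerator.apply_mem_graph hT hB hxy hr.1
    have h1 : Tendsto (fun h : ℝ => P (h⁻¹ • (T h (T r x) - T r x))
        - h⁻¹ • (T h (P (T r x)) - P (T r x))) (𝓝[>] (0 : ℝ)) (𝓝 0) := by
      have := ((P.continuous.tendsto _).comp (hB.tendsto_of_mem_graph hTr)).sub
        (hB.tendsto_of_mem_graph (hP _ _ hTr))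
      simpa using this
    have hshift : Tendsto (fun s : ℝ => s - r) (𝓝[>] r) (𝓝[>] (0 : ℝ)) := by
      refine tendsto_nhdsWithin_iff.2 ⟨?_, ?_⟩
      · have : Tendsto (fun s : ℝ => s - r) (𝓝 r) (𝓝 (r - r)) := by
          exact (continuous_id.sub continuous_const).tendsto r
        rw [sub_self] at this
        exact this.mono_left nhdsWithin_le_nhds
      · filter_upwards [self_mem_nhdsWithin] with s hs
        exact Set.mem_Ioi.2 (sub_pos.2 (Set.mem_Ioi.1 hs))
    have hlt : ∀ᶠ s in 𝓝[>] r, s < t :=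
      mem_nhdsWithin_of_mem_nhds (Iio_mem_nhds hr.2)
    have h2 := tendsto_clm_apply_of_norm_le (M := M) (A := fun s => T (t - s)) (y := 0)
      (by
        filter_upwards [self_mem_nhdsWithin, hlt] with s hs hst
        exact hM _ ⟨sub_nonneg.2 hst.le, sub_le_self _ (hr.1.trans (le_of_lt hs))⟩)
      (h1.comp hshift) (by simp)
    refine h2.congr' ?_
    filter_upwards [self_mem_nhdsWithin, hlt] with s hs hst
    have hs' : 0 ≤ s - r := sub_nonneg.2 (le_of_lt hs)
    have e1 : T s x = T (s - r) (T r x) := by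
      rw [← ContinuousLinearMap.comp_apply, ← hT.2.1 _ _ hs' hr.1, sub_add_cancel]
    have e2 : T (t - r) = (T (t - s)).comp (T (s - r)) := by
      rw [← hT.2.1 _ _ (sub_nonneg.2 hst.le) hs', sub_add_sub_cancel]
    simp only [slope_def_module, e1, e2, Function.comp_apply, ContinuousLinearMap.comp_apply,
      ← Complex.coe_smul, map_smul, map_sub, ← smul_sub]
    congr 1
    abel
  have h := constant_of_has_deriv_right_zero hcont hderiv t ⟨ht, le_rfl⟩
  simpa [hT.1] using h

/-- The domain of the generator of a `C₀`-semigroup is dense. -/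
lemma IsGenerator.dense_domain {X : Type*} [NormedAddCommGroup X] [NormedSpace ℂ X]
    [CompleteSpace X] {T : ℝ → X →L[ℂ] X} {B : X →ₗ.[ℂ] X} (hT : IsC0Semigroup T)
    (hB : IsGenerator T B) : Dense (B.domain : Set X) := by
  intro x
  set f : ℝ → X := fun s => T (max s 0) x with hf
  have hfc : Continuous f := by
    have : ContinuousOn f Set.univ :=
      (hT.2.2 x).comp (f := fun s : ℝ => max s 0) (by fun_prop) fun s _ => le_max_right s 0
    exact continuousOn_univ.1 this
  set F : ℝ → X := fun a => ∫ s in (0 : ℝ)..a, f s with hF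
  have hFd : ∀ a, HasDerivAt F (f a) a := fun a =>
    intervalIntegral.integral_hasDerivAt_right (hfc.intervalIntegrable _ _)
      hfc.stronglyMeasurable.stronglyMeasurableAtFilter hfc.continuousAt
  have hslope : ∀ a, Tendsto (fun e : ℝ => e⁻¹ • (F (a + e) - F a)) (𝓝[>] (0 : ℝ)) (𝓝 (f a)) :=
    fun a => (hFd a).tendsto_slope_zero_right
  have hF0 : F 0 = 0 := by simp [hF]
  have hmem : ∀ h : ℝ, 0 ≤ h → F h ∈ B.domain := by
    intro h hh
    refine (hB.1 _).2 ⟨f h - f 0, ?_⟩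
    refine ((hslope h).sub (hslope 0)).congr' ?_
    filter_upwards [self_mem_nhdsWithin] with e he
    have he' : (0 : ℝ) ≤ e := le_of_lt he
    have key : T e (F h) = F (h + e) - F e := by
      calc T e (F h) = ∫ s in (0 : ℝ)..h, T e (f s) :=
            ((T e).intervalIntegral_comp_comm (hfc.intervalIntegrable _ _)).symm
        _ = ∫ s in (0 : ℝ)..h, f (s + e) := by
            refine intervalIntegral.integral_congr fun s hs => ?_
            rw [Set.uIcc_of_le hh] at hs
            simp only [hf, max_eq_left hs.1, max_eq_left (add_nonneg hs.1 he')]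
            rw [add_comm s e, hT.2.1 e s he' hs.1, ContinuousLinearMap.comp_apply]
        _ = F (h + e) - F e := by
            rw [intervalIntegral.integral_comp_add_right, zero_add, hF,
              intervalIntegral.integral_interval_sub_left] <;>
            exact hfc.intervalIntegrable _ _
    rw [key, ← smul_sub, zero_add, hF0]
    congr 1
    abel
  have hx : Tendsto (fun e : ℝ => e⁻¹ • F e) (𝓝[>] (0 : ℝ)) (𝓝 x) := by
    simpa [hF0, hf, hT.1] using hslope 0
  refine mem_closure_of_tendsto hx ?_
  filter_upwards [self_mem_nhdsWithin] with e he
  rw [← Complex.coe_smul]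
  exact B.domain.smul_mem _ (hmem e (le_of_lt he))

/-- A bounded operator commuting with the generator of a `C₀`-semigroup commutes with the
semigroup. -/
lemma IsGenerator.apply_comm {X : Type*} [NormedAddCommGroup X] [NormedSpace ℂ X]
    [CompleteSpace X] {T : ℝ → X →L[ℂ] X} {B : X →ₗ.[ℂ] X} (hT : IsC0Semigroup T)
    (hB : IsGenerator T B) {P : X →L[ℂ] X}
    (hP : ∀ x y : X, (x, y) ∈ B.graph → (P x, P y) ∈ B.graph)
    {t : ℝ} (ht : 0 ≤ t) (x : X) : P (T t x) = T t (P x) :=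
  congrFun (Continuous.ext_on (IsGenerator.dense_domain hT hB) (P.comp (T t)).continuous
    ((T t).comp P).continuous fun _ hx => IsGenerator.apply_comm_of_mem_domain hT hB hP hx ht) x

/-- If a bounded operator `P` commutes with the generator `B` of a `C₀`-semigroup, then the part of
`B` in the space of fixed points of `P` generates a `C₀`-semigroup. -/
lemma IsGenerator.exists_restrict {X : Type*} [NormedAddCommGroup X] [NormedSpace ℂ X]
    [CompleteSpace X] {T : ℝ → X →L[ℂ] X} {B : X →ₗ.[ℂ] X} (hT : IsC0Semigroup T)
    (hB : IsGenerator T B) {P : X →L[ℂ] X}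
    (hP : ∀ x y : X, (x, y) ∈ B.graph → (P x, P y) ∈ B.graph)
    {K : Submodule ℂ X} (hK : ∀ x, x ∈ K ↔ P x = x) :
    (∀ x : B.domain, (x : X) ∈ K → B x ∈ K) ∧
    ∃ B' : K →ₗ.[ℂ] K,
      (∀ x y : K, (x, y) ∈ B'.graph ↔ ((x : X), (y : X)) ∈ B.graph) ∧
      ∃ S : ℝ → K →L[ℂ] K, IsC0Semigroup S ∧ IsGenerator S B' := by
  have hmaps : ∀ x : B.domain, (x : X) ∈ K → B x ∈ K := by
    intro x hx
    have h := hP _ _ (B.mem_graph x)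
    rw [(hK _).1 hx] at h
    exact (hK _).2 (B.mem_graph_snd_inj h (B.mem_graph x) rfl)
  refine ⟨hmaps, ?_⟩
  let B' : K →ₗ.[ℂ] K :=
    { domain := B.domain.comap K.subtype
      toFun := LinearMap.codRestrict K
        (B.toFun.comp ((K.subtype.comp (B.domain.comap K.subtype).subtype).codRestrict
          B.domain fun x => x.2))
        fun x => hmaps ⟨x, x.2⟩ x.1.2 }
  have hB'coe : ∀ x : B'.domain, ((B' x : K) : X) = B ⟨x, x.2⟩ := fun _ => rfl
  have hTK : ∀ (t : ℝ) (x : K), T (max t 0) x ∈ K := fun t x => by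
    rw [hK, IsGenerator.apply_comm hT hB hP (le_max_right t 0), (hK x).1 x.2]
  let S : ℝ → K →L[ℂ] K := fun t =>
    ((T (max t 0)).comp K.subtypeL).codRestrict K (hTK t)
  have hS : ∀ {t : ℝ}, 0 ≤ t → ∀ x : K, (S t x : X) = T t x := fun {t} ht x => by
    change T (max t 0) x = T t x
    rw [max_eq_left ht]
  have hquot : ∀ x y : K, Tendsto (fun t : ℝ => t⁻¹ • (S t x - x)) (𝓝[>] (0 : ℝ)) (𝓝 y) ↔
      Tendsto (fun t : ℝ => t⁻¹ • (T t (x : X) - x)) (𝓝[>] (0 : ℝ)) (𝓝 (y : X)) := by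
    intro x y
    rw [tendsto_subtype_rng]
    refine tendsto_congr' ?_
    filter_upwards [self_mem_nhdsWithin] with t ht
    rw [← hS (le_of_lt ht)]
    rfl
  have hKc : IsClosed (K : Set X) := by
    have : (K : Set X) = {x | P x = x} := Set.ext hK
    rw [this]
    exact isClosed_eq P.continuous continuous_id
  refine ⟨B', fun x y => ?_, S, ⟨?_, ?_, ?_⟩, ?_, ?_⟩
  · simp only [LinearPMap.mem_graph_iff]
    constructor
    · rintro ⟨z, rfl, rfl⟩
      exact ⟨⟨z, z.2⟩, rfl, rfl⟩
    · rintro ⟨z, hz, hz'⟩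
      refine ⟨⟨x, ?_⟩, rfl, Subtype.ext ?_⟩
      · change (x : X) ∈ B.domain
        exact hz ▸ z.2
      · rw [hB'coe, ← hz']
        exact congrArg B (Subtype.ext hz.symm)
  · ext x
    rw [hS le_rfl, hT.1]
    rfl
  · intro t u ht hu
    ext x
    rw [hS (add_nonneg ht hu), hT.2.1 t u ht hu, ContinuousLinearMap.comp_apply,
      ContinuousLinearMap.comp_apply, hS ht, hS hu]
  · intro x
    rw [Topology.IsInducing.subtypeVal.continuousOn_iff]
    exact (hT.2.2 (x : X)).congr fun t ht => hS ht x
  · intro x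
    change (x : X) ∈ B.domain ↔ _
    rw [hB.1]
    constructor
    · rintro ⟨y, hy⟩
      have hyK : y ∈ K := by
        refine hKc.mem_of_tendsto hy ?_
        filter_upwards [self_mem_nhdsWithin] with t ht
        rw [← hS (le_of_lt ht), ← Complex.coe_smul]
        exact K.smul_mem _ (K.sub_mem (S t x).2 x.2)
      exact ⟨⟨y, hyK⟩, (hquot x ⟨y, hyK⟩).2 hy⟩
    · rintro ⟨y, hy⟩
      exact ⟨y, (hquot x y).1 hy⟩
  · exact fun x => (hquot x (B' x)).2 (hB.2 ⟨x, x.2⟩)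

/-- Multiplication by the indicator function of a measurable set, as a bounded operator on `L²`. -/
lemma exists_indicator_clm {Ω H : Type*} [MeasurableSpace Ω] (μ : Measure Ω)
    [NormedAddCommGroup H] [NormedSpace ℂ H] {s : Set Ω} (hs : MeasurableSet s) :
    ∃ P : Lp H 2 μ →L[ℂ] Lp H 2 μ, ∀ x : Lp H 2 μ, P x =ᵐ[μ] s.indicator x := by
  have hcoe : ∀ x : Lp H 2 μ, ((Lp.memLp x).indicator hs).toLp _ =ᵐ[μ] s.indicator x :=
    fun x => MemLp.coeFn_toLp _
  refine ⟨LinearMap.mkContinuous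
    { toFun := fun x => ((Lp.memLp x).indicator hs).toLp _
      map_add' := fun x y => ?_
      map_smul' := fun c x => ?_ } 1 fun x => ?_, hcoe⟩
  · ext1
    filter_upwards [hcoe (x + y), hcoe x, hcoe y, Lp.coeFn_add x y, Lp.coeFn_add
      (((Lp.memLp x).indicator hs).toLp _) (((Lp.memLp y).indicator hs).toLp _)]
      with a h1 h2 h3 h4 h5
    by_cases ha : a ∈ s <;> simp_all
  · ext1
    filter_upwards [hcoe (c • x), hcoe x, Lp.coeFn_smul c x, Lp.coeFn_smul c
      (((Lp.memLp x).indicator hs).toLp _)] with a h1 h2 h3 h4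
    by_cases ha : a ∈ s <;> simp_all
  · rw [one_mul]
    refine Lp.norm_le_norm_of_ae_le ?_
    filter_upwards [hcoe x] with a ha
    simp only [LinearMap.coe_mk, AddHom.coe_mk]
    rw [ha]
    exact norm_indicator_le_norm_self _ _

/-- If the decomposable operator `𝒜` generates a `C₀`-semigroup and
`Ω' ⊆ Ω` has positive measure, then the restriction `𝒜'` of `𝒜` to the closed subspace
`K = L²(Ω')` (functions vanishing a.e. outside `Ω'`) maps its domain into `K` and generates a
`C₀`-semigroup on `K`. -/
theorem decomposable_restriction_generates
    (ν : ℂ) (R : Ω → H →L[ℂ] H)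
    (hmeasR : ∀ x : H, StronglyMeasurable fun s => R s x)
    (hbddR : ∃ C : ℝ, ∀ᵐ s ∂μ, ‖R s‖ ≤ C)
    (hinj : ∀ᵐ s ∂μ, Function.Injective (R s))
    (As : Ω → H →ₗ.[ℂ] H)
    (hres : ∀ᵐ s ∂μ, ResolventAt (As s) ν (R s))
    (𝒜 : Lp H 2 μ →ₗ.[ℂ] Lp H 2 μ)
    (h𝒜dom : ∀ x : Lp H 2 μ,
      x ∈ 𝒜.domain ↔ ∃ g : Lp H 2 μ, ∀ᵐ s ∂μ, (x s, g s) ∈ (As s).graph)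
    (h𝒜val : ∀ x : 𝒜.domain, ∀ᵐ s ∂μ, ((x : Lp H 2 μ) s, (𝒜 x) s) ∈ (As s).graph)
    (hgen : ∃ 𝒯 : ℝ → Lp H 2 μ →L[ℂ] Lp H 2 μ, IsC0Semigroup 𝒯 ∧ IsGenerator 𝒯 𝒜)
    (Ω' : Set Ω) (hΩ' : MeasurableSet Ω') (hpos : 0 < μ Ω')
    (K : Submodule ℂ (Lp H 2 μ))
    (hK : ∀ x : Lp H 2 μ, x ∈ K ↔ ∀ᵐ s ∂μ, s ∉ Ω' → x s = 0) :
    (∀ x : 𝒜.domain, (x : Lp H 2 μ) ∈ K → (𝒜 x : Lp H 2 μ) ∈ K) ∧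
    ∃ 𝒜' : K →ₗ.[ℂ] K,
      (∀ x y : K, (x, y) ∈ 𝒜'.graph ↔ ((x : Lp H 2 μ), (y : Lp H 2 μ)) ∈ 𝒜.graph) ∧
      ∃ 𝒮 : ℝ → K →L[ℂ] K, IsC0Semigroup 𝒮 ∧ IsGenerator 𝒮 𝒜' := by
  obtain ⟨T, hT, hgenT⟩ := hgen
  obtain ⟨P, hP⟩ := exists_indicator_clm (H := H) μ hΩ'
  refine IsGenerator.exists_restrict hT hgenT (P := P) ?_ fun x => ?_
  · intro x y hxy
    obtain ⟨z, rfl, rfl⟩ := (LinearPMap.mem_graph_iff 𝒜).1 hxy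
    have hgraph : ∀ᵐ s ∂μ, (P z s, P (𝒜 z) s) ∈ (As s).graph := by
      filter_upwards [h𝒜val z, hP z, hP (𝒜 z)] with s hs h1 h2
      rw [h1, h2]
      by_cases h : s ∈ Ω'
      · simpa [h] using hs
      · simp [h]
    have hmem : P z ∈ 𝒜.domain := (h𝒜dom _).2 ⟨_, hgraph⟩
    refine (LinearPMap.mem_graph_iff 𝒜).2 ⟨⟨_, hmem⟩, rfl, ?_⟩
    ext1
    filter_upwards [hgraph, h𝒜val ⟨_, hmem⟩] with s h1 h2
    exact (As s).mem_graph_snd_inj h2 h1 rfl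
  · rw [hK, Lp.ext_iff]
    constructor
    · intro h
      filter_upwards [h, hP x] with s hs h1
      rw [h1]
      by_cases h2 : s ∈ Ω' <;> simp [h2, hs]
    · intro h
      filter_upwards [h, hP x] with s hs h1 h2
      rw [← hs, h1, Set.indicator_of_notMem h2]
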